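/- Let 𝒜 be a nonempty alphabet and X ⊆ 𝒜^ℕ a subshift. Let α, β ∈ L_X and x ∈ X be such that βα⁻¹ is in reduced form in 𝔽 (i.e., α and β do not end in the same letter) and βα⁻¹ ∈ ξ_x (equivalently, x ∈ C(α,β), so x = βy for some y ∈ X with αy ∈ X). Then the left translate (αβ⁻¹)·ξ_x := {(αβ⁻¹)h : h ∈ ξ_x} equals ξ_{αy}, where y ∈ 𝒜^ℕ is determined by x = βy. -/

import Mathlib

/-! Basic subshift vocabulary. -/

/-- Concatenation of a finite word with an infinite sequence. -/
def wcat {A : Type*} (w : List A) (y : ℕ → A) : ℕ → A :=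
  fun n => if h : n < w.length then w.get ⟨n, h⟩ else y (n - w.length)

/-- `w` occurs as a (finite) factor of the sequence `x`. -/
def IsFactor {A : Type*} (w : List A) (x : ℕ → A) : Prop :=
  ∃ n : ℕ, ∀ i : Fin w.length, x (n + i) = w.get i

/-- The subshift `X_F ⊆ A^ℕ` determined by a set `F` of forbidden words. -/
def subshift {A : Type*} (Forb : Set (List A)) : Set (ℕ → A) :=
  {x | ∀ w ∈ Forb, ¬ IsFactor w x}

/-- The language of a set of sequences: all finite words (including the empty word)
occurring as factors of its elements. -/
def lang {A : Type*} (Xs : Set (ℕ → A)) : Set (List A) :=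
  {w | w = [] ∨ ∃ x ∈ Xs, IsFactor w x}

/-- `C(α, β) = {βx ∈ X : αx ∈ X}`. -/
def Cab {A : Type*} (Xs : Set (ℕ → A)) (α β : List A) : Set (ℕ → A) :=
  {z | ∃ y : ℕ → A, z = wcat β y ∧ wcat β y ∈ Xs ∧ wcat α y ∈ Xs}

/-- The element of the free group on `A` determined by a word over `A`. -/
def fgw {A : Type*} (w : List A) : FreeGroup A := (w.map FreeGroup.of).prod

/-- `ξ_x = {g ∈ 𝔽 : g = βα⁻¹ for some α, β ∈ L_X with x ∈ C(α,β)}`. -/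
def xiSet {A : Type*} (Xs : Set (ℕ → A)) (x : ℕ → A) : Set (FreeGroup A) :=
  {g | ∃ α ∈ lang Xs, ∃ β ∈ lang Xs, g = fgw β * (fgw α)⁻¹ ∧ x ∈ Cab Xs α β}

/-- `α` and `β` do not end in the same letter, i.e. `αβ⁻¹` is in reduced form. -/
def NoCommonLast {A : Type*} (α β : List A) : Prop :=
  ∀ a : A, α.getLast? = some a → β.getLast? ≠ some a

theorem wcat_nil {A : Type*} (y : ℕ → A) : wcat [] y = y := by
  funext n; simp [wcat]

theorem wcat_cons_zero {A : Type*} (a : A) (w : List A) (y : ℕ → A) :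
    wcat (a :: w) y 0 = a := by
  simp [wcat]

theorem wcat_cons_succ {A : Type*} (a : A) (w : List A) (y : ℕ → A) (n : ℕ) :
    wcat (a :: w) y (n + 1) = wcat w y n := by
  simp [wcat]

theorem wcat_cons_inj {A : Type*} {a b : A} {v w : List A} {y z : ℕ → A} :
    wcat (a :: v) y = wcat (b :: w) z ↔ a = b ∧ wcat v y = wcat w z := by
  refine ⟨fun h => ⟨?_, funext fun n => ?_⟩, fun ⟨h₁, h₂⟩ => funext fun n => ?_⟩
  · simpa only [wcat_cons_zero] using congrFun h 0
  · simpa only [wcat_cons_succ] using congrFun h (n + 1)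
  · cases n with
    | zero => simpa only [wcat_cons_zero] using h₁
    | succ n => simpa only [wcat_cons_succ] using congrFun h₂ n

theorem wcat_append {A : Type*} (v w : List A) (y : ℕ → A) :
    wcat (v ++ w) y = wcat v (wcat w y) := by
  induction v with
  | nil => rw [wcat_nil, List.nil_append]
  | cons a v ih => rw [List.cons_append, wcat_cons_inj]; exact ⟨rfl, ih⟩

theorem wcat_injective {A : Type*} (w : List A) : Function.Injective (wcat w) := by
  intro y z h
  induction w with
  | nil => simpa only [wcat_nil] using h
  | cons a w ih => exact ih (wcat_cons_inj.1 h).2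

/-- Two prefixes of one sequence are comparable. -/
theorem exists_append_of_wcat_eq {A : Type*} {v w : List A} {y z : ℕ → A}
    (h : wcat v y = wcat w z) :
    (∃ u, w = v ++ u ∧ y = wcat u z) ∨ (∃ u, v = w ++ u ∧ z = wcat u y) := by
  induction v generalizing w with
  | nil => exact .inl ⟨w, rfl, by rw [← h, wcat_nil]⟩
  | cons a v ih =>
    cases w with
    | nil => exact .inr ⟨a :: v, rfl, by rw [h, wcat_nil]⟩
    | cons b w =>
      obtain ⟨rfl, htail⟩ := wcat_cons_inj.1 h
      rcases ih htail with ⟨u, rfl, hu⟩ | ⟨u, rfl, hu⟩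
      · exact .inl ⟨u, rfl, hu⟩
      · exact .inr ⟨u, rfl, hu⟩

theorem mem_lang_of_wcat_mem {A : Type*} {Xs : Set (ℕ → A)} {w : List A} {y : ℕ → A}
    (h : wcat w y ∈ Xs) : w ∈ lang Xs :=
  .inr ⟨_, h, 0, fun i => by simp [wcat]⟩

theorem fgw_append {A : Type*} (v w : List A) : fgw (v ++ w) = fgw v * fgw w := by
  simp [fgw]

theorem fgw_eq_mk {A : Type*} (w : List A) : fgw w = FreeGroup.mk (w.map (·, true)) := by
  induction w with
  | nil => rfl
  | cons a w ih =>
    rw [← List.singleton_append, fgw_append, ih]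
    simp [fgw, FreeGroup.of]

/-- The signed word `βα⁻¹`. -/
def quotWord {A : Type*} (β α : List A) : List (A × Bool) :=
  β.map (·, true) ++ (α.map (·, false)).reverse

theorem mk_quotWord {A : Type*} (β α : List A) :
    FreeGroup.mk (quotWord β α) = fgw β * (fgw α)⁻¹ := by
  rw [fgw_eq_mk, fgw_eq_mk, FreeGroup.inv_mk, FreeGroup.mul_mk]
  simp [quotWord, FreeGroup.invRev, Function.comp_def]

theorem quotWord_inj {A : Type*} {β α β' α' : List A} (h : quotWord β α = quotWord β' α') :
    β = β' ∧ α = α' := by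
  have h₁ := congrArg (List.filterMap fun p : A × Bool => if p.2 then some p.1 else none) h
  have h₂ := congrArg (List.filterMap fun p : A × Bool => if p.2 then none else some p.1) h
  simp only [quotWord, List.filterMap_append, List.filterMap_reverse, List.filterMap_map,
    Function.comp_def] at h₁ h₂
  simpa using And.intro h₁ h₂

theorem isReduced_quotWord {A : Type*} {β α : List A} (h : NoCommonLast β α) :
    FreeGroup.IsReduced (quotWord β α) := by
  rw [FreeGroup.IsReduced, quotWord, List.isChain_append, List.isChain_reverse, List.isChain_map,
    List.isChain_map]
  refine ⟨(List.pairwise_of_forall (by simp)).isChain,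
    (List.pairwise_of_forall (by simp)).isChain, ?_⟩
  rintro ⟨a, s⟩ ha ⟨b, t⟩ hb (rfl : a = b)
  simp only [List.getLast?_map, List.head?_reverse, Option.mem_def, Option.map_eq_some_iff,
    Prod.mk.injEq] at ha hb
  obtain ⟨_, ha, rfl, -⟩ := ha
  obtain ⟨_, hb, rfl, -⟩ := hb
  exact absurd hb (h _ ha)

theorem exists_common_suffix {A : Type*} (β α : List A) :
    ∃ b a τ, β = b ++ τ ∧ α = a ++ τ ∧ NoCommonLast b a := by
  induction β using List.reverseRecOn generalizing α with
  | nil => exact ⟨[], α, [], by simp, by simp, by simp [NoCommonLast]⟩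
  | append_singleton β c ih =>
    by_cases h : NoCommonLast (β ++ [c]) α
    · exact ⟨_, _, [], by simp, by simp, h⟩
    · simp only [NoCommonLast, List.getLast?_concat, Option.some.injEq, ne_eq, not_forall,
        not_not] at h
      obtain ⟨_, rfl, h⟩ := h
      obtain ⟨α, rfl⟩ := List.getLast?_eq_some_iff.1 h
      obtain ⟨b, a, τ, rfl, rfl, hn⟩ := ih α
      exact ⟨b, a, τ ++ [c], by simp, by simp, hn⟩

theorem exists_append_of_fgw_mul_inv_eq {A : Type*} {β α β' α' : List A} (hred : NoCommonLast β α)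
    (h : fgw β * (fgw α)⁻¹ = fgw β' * (fgw α')⁻¹) :
    ∃ τ, β' = β ++ τ ∧ α' = α ++ τ := by
  classical
  obtain ⟨b, a, τ, rfl, rfl, hn⟩ := exists_common_suffix β' α'
  have h : FreeGroup.mk (quotWord β α) = FreeGroup.mk (quotWord b a) := by
    rw [mk_quotWord, mk_quotWord, h, fgw_append, fgw_append]
    group
  have hr := FreeGroup.reduce.sound h
  rw [(isReduced_quotWord hred).reduce_eq, (isReduced_quotWord hn).reduce_eq] at hr
  obtain ⟨rfl, rfl⟩ := quotWord_inj hr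
  exact ⟨τ, rfl, rfl⟩

theorem mul_mem_xiSet {A : Type*} {Xs : Set (ℕ → A)} {α β : List A} {y : ℕ → A}
    (hα : wcat α y ∈ Xs) {g : FreeGroup A} (hg : g ∈ xiSet Xs (wcat β y)) :
    fgw α * (fgw β)⁻¹ * g ∈ xiSet Xs (wcat α y) := by
  obtain ⟨γ, hγ, δ, hδ, rfl, z, hz, hδz, hγz⟩ := hg
  rcases exists_append_of_wcat_eq hz with ⟨u, rfl, rfl⟩ | ⟨u, rfl, rfl⟩
  · rw [← wcat_append] at hα ⊢
    refine ⟨γ, hγ, α ++ u, mem_lang_of_wcat_mem hα, ?_, z, rfl, hα, hγz⟩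
    rw [fgw_append, fgw_append]
    group
  · rw [← wcat_append] at hγz
    refine ⟨γ ++ u, mem_lang_of_wcat_mem hγz, α, mem_lang_of_wcat_mem hα, ?_, y, rfl, hα, hγz⟩
    rw [fgw_append, fgw_append]
    group

/-- Lemma 5.12 (equivariance): if `βα⁻¹` is in reduced form and `βα⁻¹ ∈ ξ_x`
(equivalently `x ∈ C(α,β)`, say `x = βy`), then the left translate
`(αβ⁻¹)·ξ_x` equals `ξ_{αy}`. -/
theorem stmt_12 {A : Type*} [Nonempty A] (Forb : Set (List A)) (α β : List A) (x : ℕ → A)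
    (hα : α ∈ lang (subshift Forb)) (hβ : β ∈ lang (subshift Forb))
    (hx : x ∈ subshift Forb)
    (hred : NoCommonLast β α)
    (hξ : fgw β * (fgw α)⁻¹ ∈ xiSet (subshift Forb) x)
    (y : ℕ → A) (hy : x = wcat β y) :
    (fun h => fgw α * (fgw β)⁻¹ * h) '' xiSet (subshift Forb) x =
      xiSet (subshift Forb) (wcat α y) := by
  subst hy
  have hαy : wcat α y ∈ subshift Forb := by
    obtain ⟨α', -, β', -, h, z, hz, -, hαz⟩ := hξ
    obtain ⟨τ, rfl, rfl⟩ := exists_append_of_fgw_mul_inv_eq hred h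
    rw [wcat_append] at hz hαz
    rwa [wcat_injective β hz]
  refine Set.Subset.antisymm (Set.image_subset_iff.2 fun g hg => mul_mem_xiSet hαy hg)
    fun g hg => ⟨fgw β * (fgw α)⁻¹ * g, mul_mem_xiSet hx hg, ?_⟩
  group
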